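/- Fix k ≥ 0 and set n = 14+4k. The total number of facets of L_k is f_3(L_k) = 8k² + 50k + 77 = (2k+7)(4k+11). -/

import Mathlib

/-- The representative set `{0, a 0, a 0 + a 1, …, a 0 + ⋯ + a (d-1)}` of a difference cycle
of dimension `d` on `n` vertices, as a finset of `ZMod n`. -/
def repSet (n d : ℕ) (a : ℕ → ℕ) : Finset (ZMod n) :=
  (Finset.range (d + 1)).image fun j => ((∑ i ∈ Finset.range j, a i : ℕ) : ZMod n)

/-- The difference cycle `(a 0 : … : a d)` on `n` vertices: the orbit of the representative
set under the translation `v ↦ v + 1` of `ZMod n`. -/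
def diffCycle (n d : ℕ) (a : ℕ → ℕ) : Set (Finset (ZMod n)) :=
  { G | ∃ t : ZMod n, G = (repSet n d a).image fun x => t + x }

/-- The 3-dimensional difference cycle `(b0 : b1 : b2 : b3)` on `n` vertices. -/
def dc4 (n b0 b1 b2 b3 : ℕ) : Set (Finset (ZMod n)) :=
  diffCycle n 3 fun j => if j = 0 then b0 else if j = 1 then b1 else if j = 2 then b2 else b3

/-- The complex `L_k` on `14 + 4k` vertices from Theorem 4.1 (the infinite series of
neighborly lens spaces). -/
def Lk (k : ℕ) : Set (Finset (ZMod (14 + 4 * k))) :=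
  dc4 (14 + 4 * k) 1 1 1 (11 + 4 * k) ∪ dc4 (14 + 4 * k) 1 2 4 (7 + 4 * k) ∪
    dc4 (14 + 4 * k) 1 4 2 (7 + 4 * k) ∪ dc4 (14 + 4 * k) 1 4 (7 + 4 * k) 2 ∪
    ⋃ i ∈ Finset.range (k + 1),
      (dc4 (14 + 4 * k) 2 (5 + 2 * i) 2 (5 + 4 * k - 2 * i) ∪
        dc4 (14 + 4 * k) 4 (2 + 2 * i) 4 (4 + 4 * k - 2 * i))

/-- The four-element set `{t, t + a, t + a + b, t + a + b + c}` of residues modulo `n`. -/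
def facet (n a b c : ℕ) (t : ZMod n) : Finset (ZMod n) :=
  {t, t + (a : ℕ), t + (a + b : ℕ), t + (a + b + c : ℕ)}

theorem dc4_eq_range (n a b c d : ℕ) : dc4 n a b c d = Set.range (facet n a b c) := by
  ext G
  simp only [dc4, diffCycle, repSet, Set.mem_ofPred_eq, Set.mem_range]
  refine exists_congr fun t => ?_
  rw [eq_comm]
  simp [facet, Finset.range_add_one, Finset.image_insert, Finset.sum_insert]
  constructor <;> rintro rfl <;> ext x <;> simp only [Finset.mem_insert, Finset.mem_singleton] <;>
    grind

theorem facet_rotate {n a b c d : ℕ} (h : a + b + c + d = n) (t : ZMod n) :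
    facet n a b c t = facet n b c d (t + (a : ℕ)) := by
  have h0 : (a : ZMod n) + b + c + d = 0 := by
    have := congrArg (Nat.cast : ℕ → ZMod n) h
    simpa using this
  ext x
  simp only [facet, Finset.mem_insert, Finset.mem_singleton]
  push_cast
  grind

theorem ZMod.natCast_inj_of_lt {n x y : ℕ} (hx : x < n) (hy : y < n)
    (h : (x : ZMod n) = y) : x = y := by
  rw [ZMod.natCast_eq_natCast_iff] at h
  exact Nat.ModEq.eq_of_lt_of_lt h hx hy

theorem eq_of_add_natCast_mem_facet {n a b c x : ℕ} {t : ZMod n} (h : a + b + c < n) (hx : x < n)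
    (hm : t + (x : ℕ) ∈ facet n a b c t) : x = 0 ∨ x = a ∨ x = a + b ∨ x = a + b + c := by
  simp only [facet, Finset.mem_insert, Finset.mem_singleton, add_right_inj, add_eq_left] at hm
  rcases hm with hm | hm | hm | hm
  · exact Or.inl (ZMod.natCast_inj_of_lt hx (by omega) (by simpa using hm))
  · exact Or.inr (Or.inl (ZMod.natCast_inj_of_lt hx (by omega) hm))
  · exact Or.inr (Or.inr (Or.inl (ZMod.natCast_inj_of_lt hx (by omega) hm)))
  · exact Or.inr (Or.inr (Or.inr (ZMod.natCast_inj_of_lt hx h hm)))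

theorem facet_gaps_eq {n a b c a' b' c' : ℕ} {t : ZMod n} (ha : 0 < a) (hb : 0 < b) (hc : 0 < c)
    (h : a + b + c < n) (ha' : 0 < a') (hb' : 0 < b') (hc' : 0 < c') (h' : a' + b' + c' < n)
    (he : facet n a b c t = facet n a' b' c' t) : a' = a ∧ b' = b ∧ c' = c := by
  have h1 := eq_of_add_natCast_mem_facet (x := a) (t := t) h' (by omega)
    (he ▸ by simp [facet])
  have h2 := eq_of_add_natCast_mem_facet (x := a + b) (t := t) h' (by omega)
    (he ▸ by simp [facet])
  have h3 := eq_of_add_natCast_mem_facet (x := a + b + c) (t := t) h' (by omega)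
    (he ▸ by simp [facet])
  omega

/-- Two facets agree only if their sequences of gaps are rotations of each other. -/
theorem facet_eq_facet {n a b c d a' b' c' : ℕ} {t s : ZMod n}
    (ha : 0 < a) (hb : 0 < b) (hc : 0 < c) (hd : 0 < d) (h : a + b + c + d = n)
    (ha' : 0 < a') (hb' : 0 < b') (hc' : 0 < c') (h' : a' + b' + c' < n)
    (he : facet n a b c t = facet n a' b' c' s) :
    (s = t ∧ a' = a ∧ b' = b ∧ c' = c) ∨
    (s = t + (a : ℕ) ∧ a' = b ∧ b' = c ∧ c' = d) ∨
    (s = t + (a + b : ℕ) ∧ a' = c ∧ b' = d ∧ c' = a) ∨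
    (s = t + (a + b + c : ℕ) ∧ a' = d ∧ b' = a ∧ c' = b) := by
  have hs : s ∈ facet n a b c t := he ▸ by simp [facet]
  have r1 := facet_rotate h t
  have r2 := facet_rotate (show b + c + d + a = n by omega) (t + (a : ℕ))
  have r3 := facet_rotate (show c + d + a + b = n by omega) (t + (a : ℕ) + (b : ℕ))
  rw [add_assoc t, ← Nat.cast_add] at r2 r3
  rw [add_assoc t, ← Nat.cast_add] at r3
  simp only [facet, Finset.mem_insert, Finset.mem_singleton] at hs
  rcases hs with rfl | rfl | rfl | rfl
  · exact Or.inl ⟨rfl, facet_gaps_eq ha hb hc (by omega) ha' hb' hc' h' he⟩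
  · exact Or.inr (Or.inl ⟨rfl, facet_gaps_eq hb hc hd (by omega) ha' hb' hc' h' (r1 ▸ he)⟩)
  · exact Or.inr (Or.inr (Or.inl
      ⟨rfl, facet_gaps_eq hc hd ha (by omega) ha' hb' hc' h' (r2 ▸ r1 ▸ he)⟩))
  · exact Or.inr (Or.inr (Or.inr
      ⟨rfl, facet_gaps_eq hd ha hb (by omega) ha' hb' hc' h' (r3 ▸ r2 ▸ r1 ▸ he)⟩))

theorem disjoint_dc4 {n a b c d a' b' c' d' : ℕ}
    (h : 0 < a ∧ 0 < b ∧ 0 < c ∧ 0 < d ∧ a + b + c + d = n)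
    (h' : 0 < a' ∧ 0 < b' ∧ 0 < c' ∧ 0 < d' ∧ a' + b' + c' + d' = n)
    (hne : ¬(a' = a ∧ b' = b ∧ c' = c) ∧ ¬(a' = b ∧ b' = c ∧ c' = d) ∧
      ¬(a' = c ∧ b' = d ∧ c' = a) ∧ ¬(a' = d ∧ b' = a ∧ c' = b)) :
    Disjoint (dc4 n a b c d) (dc4 n a' b' c' d') := by
  rw [dc4_eq_range, dc4_eq_range, Set.disjoint_left]
  rintro _ ⟨t, rfl⟩ ⟨s, hs⟩
  have := facet_eq_facet h.1 h.2.1 h.2.2.1 h.2.2.2.1 h.2.2.2.2 h'.1 h'.2.1 h'.2.2.1 (by omega)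
    hs.symm
  tauto

theorem ncard_dc4 {n a b c d : ℕ}
    (h : 0 < a ∧ 0 < b ∧ 0 < c ∧ 0 < d ∧ a + b + c + d = n)
    (hne : ¬(a = c ∧ b = d)) : (dc4 n a b c d).ncard = n := by
  rw [dc4_eq_range, ← Set.image_univ, Set.ncard_image_of_injective, Set.ncard_univ, Nat.card_zmod]
  intro t s hs
  rcases facet_eq_facet h.1 h.2.1 h.2.2.1 h.2.2.2.1 h.2.2.2.2 h.1 h.2.1 h.2.2.1 (by omega) hs with
    ⟨e, -⟩ | ⟨-, e⟩ | ⟨-, e⟩ | ⟨-, e⟩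
  · exact e.symm
  all_goals omega

/-- A difference cycle with gaps of period exactly two has half the full length. -/
theorem ncard_dc4_of_period_two {n a b : ℕ} (ha : 0 < a) (hb : 0 < b) (hab : a ≠ b)
    (h : a + b + a + b = n) : (dc4 n a b a b).ncard = a + b := by
  have : NeZero n := ⟨by omega⟩
  have himage : dc4 n a b a b =
      (fun j : ℕ => facet n a b a (j : ZMod n)) '' (Finset.range (a + b) : Set ℕ) := by
    rw [dc4_eq_range]
    apply Set.Subset.antisymm
    · rintro _ ⟨t, rfl⟩
      have ht := ZMod.val_lt t
      by_cases hlt : t.val < a + b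
      · exact ⟨t.val, by simpa using hlt, by simp⟩
      · refine ⟨t.val - (a + b), by simp; omega, ?_⟩
        have e : t = ((t.val - (a + b) : ℕ) : ZMod n) + (a : ℕ) + (b : ℕ) := by
          conv_lhs => rw [← ZMod.natCast_zmod_val t]
          norm_cast
          congr 1
          omega
        change facet n a b a _ = _
        rw [facet_rotate h, facet_rotate (show b + a + b + a = n by omega), ← e]
    · rintro _ ⟨j, -, rfl⟩
      exact ⟨j, rfl⟩
  rw [himage, Set.InjOn.ncard_image, Set.ncard_coe_finset, Finset.card_range]
  intro i hi j hj hij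
  simp only [Finset.coe_range, Set.mem_Iio] at hi hj
  rcases facet_eq_facet ha hb ha hb h ha hb ha (by omega) hij with
    ⟨e, -⟩ | ⟨-, e⟩ | ⟨e, -⟩ | ⟨-, e⟩
  · exact (ZMod.natCast_inj_of_lt (by omega) (by omega) e).symm
  · omega
  · rw [← Nat.cast_add] at e
    have := ZMod.natCast_inj_of_lt (by omega) (by omega) e
    omega
  · omega

theorem ncard_Lk_family {k m : ℕ} (hm : m ≤ k) :
    (⋃ i ∈ Finset.range m,
      (dc4 (14 + 4 * k) 2 (5 + 2 * i) 2 (5 + 4 * k - 2 * i) ∪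
        dc4 (14 + 4 * k) 4 (2 + 2 * i) 4 (4 + 4 * k - 2 * i))).ncard = m * (2 * (14 + 4 * k)) := by
  have : NeZero (14 + 4 * k) := ⟨by omega⟩
  induction m with
  | zero => simp
  | succ m ih =>
    rw [Finset.range_add_one, Finset.set_biUnion_insert, Set.ncard_union_eq ?_ (Set.toFinite _)
      (Set.toFinite _), ih (by omega), Set.ncard_union_eq ?_ (Set.toFinite _) (Set.toFinite _),
      ncard_dc4 (by omega) (by omega), ncard_dc4 (by omega) (by omega)]
    · ring
    · exact disjoint_dc4 (by omega) (by omega) (by omega)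
    · simp only [Set.disjoint_iUnion_right, Set.disjoint_union_left, Set.disjoint_union_right,
        Finset.mem_range]
      intro i hi
      refine ⟨⟨?_, ?_⟩, ?_, ?_⟩ <;> exact disjoint_dc4 (by omega) (by omega) (by omega)

/-- The total number of facets of `L_k` is `f₃(L_k) = 8k² + 50k + 77 = (2k+7)(4k+11)`. -/
theorem Lk_facet_count (k : ℕ) :
    (Lk k).ncard = 8 * k ^ 2 + 50 * k + 77 ∧
      8 * k ^ 2 + 50 * k + 77 = (2 * k + 7) * (4 * k + 11) := by
  refine ⟨?_, by ring⟩
  have : NeZero (14 + 4 * k) := ⟨by omega⟩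
  have hhalf : (dc4 (14 + 4 * k) 2 (5 + 2 * k) 2 (5 + 4 * k - 2 * k)).ncard = 7 + 2 * k := by
    rw [show 5 + 4 * k - 2 * k = 5 + 2 * k by omega,
      ncard_dc4_of_period_two (by omega) (by omega) (by omega) (by omega)]
    omega
  have hfam : (⋃ i ∈ Finset.range (k + 1),
      (dc4 (14 + 4 * k) 2 (5 + 2 * i) 2 (5 + 4 * k - 2 * i) ∪
        dc4 (14 + 4 * k) 4 (2 + 2 * i) 4 (4 + 4 * k - 2 * i))).ncard =
      7 + 2 * k + (14 + 4 * k) + k * (2 * (14 + 4 * k)) := by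
    rw [Finset.range_add_one, Finset.set_biUnion_insert, Set.ncard_union_eq ?_ (Set.toFinite _)
      (Set.toFinite _), ncard_Lk_family le_rfl, Set.ncard_union_eq ?_ (Set.toFinite _)
      (Set.toFinite _), hhalf, ncard_dc4 (by omega) (by omega)]
    · exact disjoint_dc4 (by omega) (by omega) (by omega)
    · simp only [Set.disjoint_iUnion_right, Set.disjoint_union_left, Set.disjoint_union_right,
        Finset.mem_range]
      intro i hi
      refine ⟨⟨?_, ?_⟩, ?_, ?_⟩ <;> exact disjoint_dc4 (by omega) (by omega) (by omega)
  rw [Lk, Set.ncard_union_eq ?_ (Set.toFinite _) (Set.toFinite _), hfam,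
    Set.ncard_union_eq ?_ (Set.toFinite _) (Set.toFinite _),
    Set.ncard_union_eq ?_ (Set.toFinite _) (Set.toFinite _),
    Set.ncard_union_eq ?_ (Set.toFinite _) (Set.toFinite _),
    ncard_dc4 (by omega) (by omega), ncard_dc4 (by omega) (by omega),
    ncard_dc4 (by omega) (by omega), ncard_dc4 (by omega) (by omega)]
  · ring
  · exact disjoint_dc4 (by omega) (by omega) (by omega)
  · simp only [Set.disjoint_union_left]
    refine ⟨?_, ?_⟩ <;> exact disjoint_dc4 (by omega) (by omega) (by omega)
  · simp only [Set.disjoint_union_left]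
    refine ⟨⟨?_, ?_⟩, ?_⟩ <;> exact disjoint_dc4 (by omega) (by omega) (by omega)
  · simp only [Set.disjoint_iUnion_right, Set.disjoint_union_left, Set.disjoint_union_right,
      Finset.mem_range]
    intro i hi
    refine ⟨⟨⟨⟨?_, ?_⟩, ?_⟩, ?_⟩, ⟨⟨?_, ?_⟩, ?_⟩, ?_⟩ <;>
      exact disjoint_dc4 (by omega) (by omega) (by omega)
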